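/- Let b, c, k₁, σ > 0 with b·σ·√(2π) > k₁, and let θ̂(μ) denote the unique solution of b·θ + c + k₁ = k₁·Φ((θ − μ)/σ). Then for every κ > 0 the function μ ↦ Φ(κ·(θ̂(μ) − μ)) is strictly decreasing on ℝ. -/

import Mathlib

open Real MeasureTheory

/-- The standard normal cumulative distribution function
`Φ(z) = (1/√(2π)) ∫_{−∞}^{z} exp(−t²/2) dt`. -/
noncomputable def stdNormalCDF (z : ℝ) : ℝ :=
  (Real.sqrt (2 * Real.pi))⁻¹ * ∫ t in Set.Iic z, Real.exp (-t ^ 2 / 2)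

lemma integrable_exp_neg_sq_div_two : Integrable (fun t : ℝ => Real.exp (-t ^ 2 / 2)) := by
  convert integrable_exp_neg_mul_sq (b := 1 / 2) (by norm_num) using 3
  ring

lemma stdNormalCDF_sub (x y : ℝ) : stdNormalCDF y - stdNormalCDF x =
    (Real.sqrt (2 * Real.pi))⁻¹ * ∫ t in x..y, Real.exp (-t ^ 2 / 2) := by
  rw [stdNormalCDF, stdNormalCDF, ← mul_sub, intervalIntegral.integral_Iic_sub_Iic
    integrable_exp_neg_sq_div_two.integrableOn integrable_exp_neg_sq_div_two.integrableOn]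

lemma stdNormalCDF_strictMono : StrictMono stdNormalCDF := by
  intro x y hxy
  rw [← sub_pos, stdNormalCDF_sub]
  have hI : 0 < ∫ t in x..y, Real.exp (-t ^ 2 / 2) :=
    intervalIntegral.intervalIntegral_pos_of_pos
      integrable_exp_neg_sq_div_two.intervalIntegrable (fun _ => Real.exp_pos _) hxy
  positivity

lemma stdNormalCDF_sub_le {x y : ℝ} (hxy : x ≤ y) :
    stdNormalCDF y - stdNormalCDF x ≤ (Real.sqrt (2 * Real.pi))⁻¹ * (y - x) := by
  rw [stdNormalCDF_sub]
  gcongr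
  calc ∫ t in x..y, Real.exp (-t ^ 2 / 2) ≤ ∫ _ in x..y, (1 : ℝ) :=
        intervalIntegral.integral_mono hxy
          integrable_exp_neg_sq_div_two.intervalIntegrable intervalIntegrable_const
          fun t => Real.exp_le_one_iff.2 (by nlinarith [sq_nonneg t])
    _ = y - x := by simp

/-- Proposition 1(ii): in the unique-equilibrium case (`b·σ·√(2π) > k₁`), if
`θ̂(μ)` denotes the unique solution of `b·θ + c + k₁ = k₁·Φ((θ − μ)/σ)`, then
for every `κ > 0` the expected protest level `μ ↦ Φ(κ·(θ̂(μ) − μ))` is strictly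
decreasing in the interim belief `μ` (hence in the election result). -/
theorem stmt10 (b c k₁ σ : ℝ) (hb : 0 < b) (hc : 0 < c) (hk : 0 < k₁) (hσ : 0 < σ)
    (hslope : b * σ * Real.sqrt (2 * Real.pi) > k₁)
    (f : ℝ → ℝ)
    (hf : ∀ μ : ℝ, b * f μ + c + k₁ = k₁ * stdNormalCDF ((f μ - μ) / σ))
    (κ : ℝ) (hκ : 0 < κ) :
    StrictAnti (fun μ : ℝ => stdNormalCDF (κ * (f μ - μ))) := by
  intro μ₁ μ₂ hμ
  refine stdNormalCDF_strictMono (mul_lt_mul_of_pos_left ?_ hκ)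
  by_contra! hle
  have hs : 0 < Real.sqrt (2 * Real.pi) := by positivity
  have hΦ := mul_le_mul_of_nonneg_left
    (stdNormalCDF_sub_le (div_le_div_of_nonneg_right hle hσ.le)) hk.le
  have hbound : k₁ * ((Real.sqrt (2 * Real.pi))⁻¹ *
      ((f μ₂ - μ₂) / σ - (f μ₁ - μ₁) / σ)) ≤ b * ((f μ₂ - μ₂) - (f μ₁ - μ₁)) := by
    calc _ = k₁ / (σ * Real.sqrt (2 * Real.pi)) * ((f μ₂ - μ₂) - (f μ₁ - μ₁)) := by
          field_simp
      _ ≤ _ := by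
          refine mul_le_mul_of_nonneg_right ?_ (sub_nonneg.2 hle)
          rw [div_le_iff₀ (by positivity)]
          linarith
  nlinarith [hf μ₁, hf μ₂, mul_pos hb (sub_pos.2 hμ)]
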